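/- For all m ≥ 0 and all k_0, k_1, …, k_m ∈ ℤ∖{0}, in H_{1,m+1}(q) one can write t^{k_0} (t′_1)^{k_1} ⋯ (t′_m)^{k_m} = q^{−Σ_{n=1}^{m} n k_n} · t^{k_0} t_1^{k_1} ⋯ t_m^{k_m} + Σ_i f_i · t^{k_0} t_1^{k_1} ⋯ t_m^{k_m} · w_i + Σ_j g_j · τ_j · u_j, where the sums are finite, f_i, g_j ∈ R, w_i, u_j ∈ H_{m+1}(q), and each τ_j is a monomial in the t_i's (with strictly increasing indices and nonzero exponents) satisfying τ_j < t^{k_0} t_1^{k_1} ⋯ t_m^{k_m} in the ordering of monomials. -/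

import Mathlib

set_option synthInstance.maxHeartbeats 1000000
set_option maxHeartbeats 2000000

namespace MB

/-! ## The mixed braid group `B_{1,n}` (with `m = n - 1` braiding generators) -/

/-- Generators: `none` is the looping generator `t`, `some i` is `σ_{i+1}` for `i : Fin m`. -/
abbrev MBGen (m : ℕ) := Option (Fin m)

/-- The relators of the mixed braid group `B_{1,n}` (`m = n-1`):
`σ₁tσ₁t = tσ₁tσ₁`; `tσ_i = σ_i t` for `i > 1`; the braid relations among the `σ_i`. -/
def rels (m : ℕ) : Set (FreeGroup (MBGen m)) :=
  { r | (∃ h : 0 < m,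
          r = (FreeGroup.of (some ⟨0, h⟩) * FreeGroup.of none) ^ 2 *
              ((FreeGroup.of (none : MBGen m) * FreeGroup.of (some ⟨0, h⟩)) ^ 2)⁻¹) ∨
        (∃ i : Fin m, 1 ≤ (i : ℕ) ∧
          r = FreeGroup.of (none : MBGen m) * FreeGroup.of (some i) *
              (FreeGroup.of (some i) * FreeGroup.of (none : MBGen m))⁻¹) ∨
        (∃ i j : Fin m, (i : ℕ) + 1 = (j : ℕ) ∧
          r = FreeGroup.of (some i) * FreeGroup.of (some j) * FreeGroup.of (some i) *
              (FreeGroup.of (some j) * FreeGroup.of (some i) * FreeGroup.of (some j))⁻¹) ∨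
        (∃ i j : Fin m, (i : ℕ) + 1 < (j : ℕ) ∧
          r = FreeGroup.of (some i) * FreeGroup.of (some j) *
              (FreeGroup.of (some j) * FreeGroup.of (some i))⁻¹) }

/-- The mixed braid group `B_{1,n}` with `n = m+1` moving strands. -/
abbrev B (m : ℕ) := PresentedGroup (rels m)

/-- The braiding generator `σ_{i+1}`, for `i : Fin m`. -/
def σ {m : ℕ} (i : Fin m) : B m := PresentedGroup.of (some i)

/-- The looping generator `t`. -/
def τ {m : ℕ} : B m := PresentedGroup.of none

/-- `σ_j` in one-based indexing (`1 ≤ j ≤ m`), junk value `1` out of range. -/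
def sig {m : ℕ} (j : ℕ) : B m :=
  if h : 1 ≤ j ∧ j - 1 < m then σ ⟨j - 1, h.2⟩ else 1

/-- The looping elements `t_i = σ_i ⋯ σ_1 t σ_1 ⋯ σ_i` (for `0 ≤ i ≤ m`), via `t_0 = t`,
`t_{j+1} = σ_{j+1} t_j σ_{j+1}`. -/
def tt {m : ℕ} : ℕ → B m
  | 0 => τ
  | (j+1) => sig (j+1) * tt j * sig (j+1)

/-- The looping elements `t′_i = σ_i ⋯ σ_1 t σ_1⁻¹ ⋯ σ_i⁻¹` (for `0 ≤ i ≤ m`), via `t′_0 = t`,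
`t′_{j+1} = σ_{j+1} t′_j σ_{j+1}⁻¹`. -/
def tp {m : ℕ} : ℕ → B m
  | 0 => τ
  | (j+1) => sig (j+1) * tp j * (sig (j+1))⁻¹

/-! ## The generalized Iwahori–Hecke algebra of type B, `H_{1,n}(q)` -/

/-- The ground ring `R = ℂ[q^{±1}]` of Laurent polynomials. -/
abbrev R : Type := LaurentPolynomial ℂ

instance : IsDomain R := NoZeroDivisors.to_isDomain _

/-- The variable `q ∈ R`. -/
noncomputable def qq : R := LaurentPolynomial.T 1

/-- The quadratic Hecke relations `σ_i² = (q-1)σ_i + q`. -/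
inductive heckeRel (m : ℕ) :
    MonoidAlgebra R (B m) → MonoidAlgebra R (B m) → Prop
  | quad (i : Fin m) : heckeRel m
      (MonoidAlgebra.of R (B m) (σ i) * MonoidAlgebra.of R (B m) (σ i))
      ((qq - 1) • MonoidAlgebra.of R (B m) (σ i) + qq • (1 : MonoidAlgebra R (B m)))

/-- The generalized Iwahori–Hecke algebra of type B, `H_{1,n}(q)` (`n = m+1`), as the quotient
of the group algebra `R[B_{1,n}]` by the two-sided ideal generated by the quadratic relations. -/
abbrev H (m : ℕ) := RingQuot (heckeRel m)

/-- The canonical multiplicative map `π : B_{1,n} → H_{1,n}(q)`. -/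
noncomputable def pih (m : ℕ) : B m →* H m :=
  (RingQuot.mkRingHom (heckeRel m)).toMonoidHom.comp (MonoidAlgebra.of R (B m))

/-- The subalgebra `H_n(q)` of `H_{1,n}(q)` generated by the images `g_1, …, g_{n-1}`
of `σ_1, …, σ_{n-1}`. -/
noncomputable def HA (m : ℕ) : Subalgebra R (H m) :=
  Algebra.adjoin R (Set.range fun i : Fin m => pih m (σ i))

/-! ## Monomials in the `t_i`'s and their ordering -/

/-- A monomial `t_{i_1}^{k_1} ⋯ t_{i_r}^{k_r}` in the `t_i`'s, with strictly increasing
indices `≤ m` and nonzero exponents. -/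
structure TMon (m : ℕ) where
  r : ℕ
  ind : Fin r → ℕ
  ke : Fin r → ℤ
  mono : StrictMono ind
  bdd : ∀ j, ind j ≤ m
  nz : ∀ j, ke j ≠ 0

/-- The element of `B_{1,n}` represented by a monomial in the `t_i`'s. -/
def TMon.elem {m : ℕ} (T : TMon m) : B m :=
  (List.ofFn fun j => tt (T.ind j) ^ T.ke j).prod

/-- The exponent sum of a monomial. -/
def TMon.expSum {m : ℕ} (T : TMon m) : ℤ := ∑ j, T.ke j

/-- The index of a monomial: the highest index occurring (`0` for the empty monomial). -/
def TMon.topIdx {m : ℕ} (T : TMon m) : ℕ := ((List.ofFn T.ind).getLast?).getD 0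

/-- The ordering on monomials in the `t_i`'s: compare exponent sums, then indices, then
(at the first differing position) the index sequences, then (at the last differing
position) the absolute values and signs of exponents. -/
def TMon.lt {m : ℕ} (T U : TMon m) : Prop :=
  T.expSum < U.expSum ∨
  (T.expSum = U.expSum ∧
    (T.topIdx < U.topIdx ∨
      (T.topIdx = U.topIdx ∧
        ((∃ (a : ℕ) (ha : a < T.r) (hb : a < U.r),
            (∀ (b : ℕ) (hb1 : b < T.r) (hb2 : b < U.r), b < a →
              T.ind ⟨b, hb1⟩ = U.ind ⟨b, hb2⟩) ∧
            U.ind ⟨a, hb⟩ < T.ind ⟨a, ha⟩) ∨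
          (List.ofFn T.ind = List.ofFn U.ind ∧
            ∃ (a : ℕ) (ha : a < T.r) (hb : a < U.r),
              T.ke ⟨a, ha⟩ ≠ U.ke ⟨a, hb⟩ ∧
              (∀ (b : ℕ) (hb1 : b < T.r) (hb2 : b < U.r), a < b →
                T.ke ⟨b, hb1⟩ = U.ke ⟨b, hb2⟩) ∧
              (|T.ke ⟨a, ha⟩| < |U.ke ⟨a, hb⟩| ∨
                (|T.ke ⟨a, ha⟩| = |U.ke ⟨a, hb⟩| ∧ U.ke ⟨a, hb⟩ < T.ke ⟨a, ha⟩)))))))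

section Generic

variable {K A : Type*} [CommRing K] [Ring A] [Algebra K A]

/-- Generic data satisfied by the images of the generators in the Hecke algebra. -/
structure Dat (K A : Type*) [CommRing K] [Ring A] [Algebra K A] (m : ℕ) where
  S : Subalgebra K A
  q : K
  qi : K
  hq : q * qi = 1
  G : ℕ → Aˣ
  T : ℕ → Aˣ
  hT : ∀ i, T (i+1) = G (i+1) * T i * G (i+1)
  commT : ∀ i j, i ≤ m → j ≤ m → Commute (T i) (T j)
  commG : ∀ i l, i + 1 ≤ m → l ≤ m → l ≠ i → l ≠ i + 1 → Commute (G (i+1)) (T l)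
  quad : ∀ i, i + 1 ≤ m → (G (i+1) : A) * G (i+1) = (q - 1) • (G (i+1) : A) + q • (1 : A)
  memG : ∀ i, i + 1 ≤ m → (G (i+1) : A) ∈ S

theorem inv_formula (q qi : K) (hq : q * qi = 1) (g : Aˣ)
    (hg : (g : A) * g = (q - 1) • (g : A) + q • (1 : A)) :
    ((g⁻¹ : Aˣ) : A) = qi • (g : A) + (qi - 1) • (1 : A) := by
  have h1 : (g : A) * (qi • (g : A) + (qi - 1) • (1 : A)) = 1 := by
    rw [mul_add, mul_smul_comm, mul_smul_comm, hg, mul_one, smul_add, smul_smul, smul_smul,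
      mul_comm qi q, hq, one_smul, add_right_comm, ← add_smul]
    have : qi * (q - 1) + (qi - 1) = 0 := by linear_combination hq
    rw [this, zero_smul, zero_add]
  calc ((g⁻¹ : Aˣ) : A) = ((g⁻¹ : Aˣ) : A) * ((g : A) * (qi • (g : A) + (qi - 1) • (1 : A))) := by
        rw [h1, mul_one]
    _ = _ := by rw [← mul_assoc, Units.inv_mul, one_mul]

theorem form2 (q qi : K) (hq : q * qi = 1) (g : Aˣ)
    (hg : (g : A) * g = (q - 1) • (g : A) + q • (1 : A)) :
    (g : A) = q • ((g⁻¹ : Aˣ) : A) + (q - 1) • (1 : A) := by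
  rw [inv_formula q qi hq g hg, smul_add, smul_smul, smul_smul, hq, one_smul, add_assoc, ← add_smul]
  have : q * (qi - 1) + (q - 1) = 0 := by linear_combination hq
  rw [this, zero_smul, add_zero]

/-- Span of two-variable monomials. -/
def two (S : Subalgebra K A) (x y : Aˣ) (Q : ℤ → ℤ → Prop) : Submodule K A :=
  Submodule.span K {z | ∃ c d h, h ∈ S ∧ Q c d ∧ z = ((x ^ c * y ^ d : Aˣ) : A) * h}

theorem two_mem {S : Subalgebra K A} {x y : Aˣ} {Q : ℤ → ℤ → Prop} {c d : ℤ} {h : A} (hh : h ∈ S)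
    (hQ : Q c d) : ((x ^ c * y ^ d : Aˣ) : A) * h ∈ two S x y Q :=
  Submodule.subset_span ⟨c, d, h, hh, hQ, rfl⟩

theorem two_map {S : Subalgebra K A} {x y : Aˣ} (hxy : Commute x y) {Q Q' : ℤ → ℤ → Prop} (a b : ℤ)
    (hQ : ∀ c d, Q c d → Q' (c + a) (d + b)) {z : A} (hz : z ∈ two S x y Q) :
    ((x ^ a * y ^ b : Aˣ) : A) * z ∈ two S x y Q' := by
  refine Submodule.span_induction ?_ ?_ ?_ ?_ hz
  · rintro _ ⟨c, d, h, hh, hq, rfl⟩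
    rw [← mul_assoc, ← Units.val_mul]
    have : x ^ a * y ^ b * (x ^ c * y ^ d) = x ^ (c + a) * y ^ (d + b) := by
      rw [mul_assoc, ← mul_assoc (y ^ b), ((hxy.zpow_zpow c b).eq).symm, mul_assoc, ← mul_assoc,
        ← zpow_add, ← zpow_add, add_comm a, add_comm b]
    rw [this]
    exact two_mem hh (hQ _ _ hq)
  · simp
  · intro u v _ _ hu hv
    rw [mul_add]; exact add_mem hu hv
  · intro r u _ hu
    rw [mul_smul_comm]; exact Submodule.smul_mem _ _ hu

theorem two_pos (S : Subalgebra K A) (q qi : K) (hq : q * qi = 1) (g x y : Aˣ)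
    (hg : (g : A) * g = (q - 1) • (g : A) + q • (1 : A)) (hgS : (g : A) ∈ S)
    (hy : y = g * x * g) (hxy : Commute x y) (n : ℕ) :
    (g : A) * ((x ^ (n : ℤ) : Aˣ) : A) ∈
      two S x y (fun c d => c + d = n ∧ 0 ≤ d ∧ (d < n ∨ (c = 0 ∧ d = n))) := by
  induction n with
  | zero =>
    have := two_mem (S := S) (x := x) (y := y)
      (Q := (fun c d => c + d = (0 : ℕ) ∧ 0 ≤ d ∧ (d < (0 : ℕ) ∨ (c = 0 ∧ d = (0 : ℕ)))))
      (c := 0) (d := 0) hgS (by simp)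
    simpa using this
  | succ n ih =>
    have e1 : (g : A) * ((x ^ ((n + 1 : ℕ) : ℤ) : Aˣ) : A)
        = qi • (((x ^ (0 : ℤ) * y ^ (1 : ℤ) : Aˣ) : A) * ((g : A) * ((x ^ (n : ℤ) : Aˣ) : A)))
          + (qi - 1) • (((x ^ (n : ℤ) * y ^ (1 : ℤ) : Aˣ) : A) * 1) := by
      have : g * x ^ ((n + 1 : ℕ) : ℤ) = y * g⁻¹ * x ^ (n : ℤ) := by
        rw [hy]; push_cast; rw [zpow_add, zpow_one, ((Commute.refl x).zpow_left _).eq]; group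
      rw [← Units.val_mul, this, Units.val_mul, Units.val_mul, inv_formula q qi hq g hg,
        (hxy.zpow_zpow n 1).eq]
      simp only [zpow_zero, one_mul, zpow_one, mul_add, add_mul, mul_smul_comm, smul_mul_assoc,
        mul_one, Units.val_mul, mul_assoc]
    rw [e1]
    refine add_mem (Submodule.smul_mem _ _ (two_map hxy 0 1 ?_ ih)) (Submodule.smul_mem _ _ ?_)
    · intro c d; push_cast; omega
    · refine two_mem S.one_mem ?_
      omega

theorem two_neg (S : Subalgebra K A) (q qi : K) (hq : q * qi = 1) (g x y : Aˣ)
    (hg : (g : A) * g = (q - 1) • (g : A) + q • (1 : A)) (hgS : (g : A) ∈ S)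
    (hy : y = g * x * g) (hxy : Commute x y) (n : ℕ) :
    (g : A) * ((x ^ (-(n : ℤ)) : Aˣ) : A) ∈
      two S x y (fun c d => c + d = -n ∧ d ≤ 0 ∧ (-n < d ∨ (c = 0 ∧ d = -n))) := by
  induction n with
  | zero =>
    have := two_mem (S := S) (x := x) (y := y)
      (Q := (fun c d => c + d = -(0 : ℕ) ∧ d ≤ 0 ∧ (-(0 : ℕ) < d ∨ (c = 0 ∧ d = -(0 : ℕ)))))
      (c := 0) (d := 0) hgS (by simp)
    simpa using this
  | succ n ih =>
    have e1 : (g : A) * ((x ^ (-((n + 1 : ℕ) : ℤ)) : Aˣ) : A)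
        = q • (((x ^ (0 : ℤ) * y ^ (-1 : ℤ) : Aˣ) : A) * ((g : A) * ((x ^ (-(n : ℤ)) : Aˣ) : A)))
          + (q - 1) • (((x ^ (-((n + 1 : ℕ) : ℤ)) * y ^ (0 : ℤ) : Aˣ) : A) * 1) := by
      have : g⁻¹ * x ^ (-((n + 1 : ℕ) : ℤ)) = y⁻¹ * (g * x ^ (-(n : ℤ))) := by
        rw [hy]; push_cast
        rw [show (-((n : ℤ) + 1)) = (-1) + -n by ring, zpow_add]; group
      conv_lhs => rw [form2 q qi hq g hg]
      rw [add_mul, smul_mul_assoc, ← Units.val_mul, this]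
      simp
    rw [e1]
    refine add_mem (Submodule.smul_mem _ _ (two_map hxy 0 (-1) ?_ ih)) (Submodule.smul_mem _ _ ?_)
    · intro c d; push_cast; omega
    · refine two_mem S.one_mem ?_
      omega

theorem two_mono {S : Subalgebra K A} {x y : Aˣ} {Q Q' : ℤ → ℤ → Prop}
    (h : ∀ c d, Q c d → Q' c d) : two S x y Q ≤ two S x y Q' := by
  apply Submodule.span_mono
  rintro z ⟨c, d, k, hk, hQ, rfl⟩
  exact ⟨c, d, k, hk, h _ _ hQ, rfl⟩

theorem two_all (S : Subalgebra K A) (q qi : K) (hq : q * qi = 1) (g x y : Aˣ)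
    (hg : (g : A) * g = (q - 1) • (g : A) + q • (1 : A)) (hgS : (g : A) ∈ S)
    (hy : y = g * x * g) (hxy : Commute x y) (a b : ℤ) :
    (g : A) * ((x ^ a * y ^ b : Aˣ) : A) ∈
      two S x y (fun c d => c + d = a + b ∧ (b = 0 → (|d| < |a| ∨ (c = 0 ∧ d = a)))) := by
  have h0 : (g : A) * ((x ^ (a - b) : Aˣ) : A) ∈
      two S x y (fun c d => c + d = a - b ∧ (|d| < |a - b| ∨ (c = 0 ∧ d = a - b))) := by
    obtain ⟨n, hn | hn⟩ := Int.eq_nat_or_neg (a - b)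
    · rw [hn]
      refine two_mono ?_ (two_pos S q qi hq g x y hg hgS hy hxy n)
      rintro c d ⟨h1, h2, h3⟩
      refine ⟨h1, h3.imp (fun h => ?_) id⟩
      rw [abs_of_nonneg h2, abs_of_nonneg (by positivity)]; exact h
    · rw [hn]
      refine two_mono ?_ (two_neg S q qi hq g x y hg hgS hy hxy n)
      rintro c d ⟨h1, h2, h3⟩
      refine ⟨h1, h3.imp (fun h => ?_) id⟩
      rw [abs_of_nonpos h2, abs_of_nonpos (by omega)]; omega
  have hc : Commute g (x * y) := by
    have := hxy.eq
    rw [hy] at this ⊢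
    show g * (x * (g * x * g)) = x * (g * x * g) * g
    calc g * (x * (g * x * g)) = (g * x * g * x) * g := by simp only [mul_assoc]
      _ = _ := by rw [← this]
  have e : g * (x ^ a * y ^ b) = (x ^ b * y ^ b) * (g * x ^ (a - b)) := by
    rw [← hxy.mul_zpow, ← mul_assoc ((x * y) ^ b), ← (hc.zpow_right b).eq, mul_assoc, hxy.mul_zpow]
    congr 1
    rw [mul_assoc, ← (hxy.zpow_zpow _ b).eq, ← mul_assoc, ← zpow_add]; congr 2; ring
  rw [← Units.val_mul, e, Units.val_mul, Units.val_mul]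
  refine two_map hxy b b ?_ h0
  rintro c d ⟨h1, h2⟩
  refine ⟨by omega, ?_⟩
  rintro rfl
  simpa using h2

namespace Dat

variable {m : ℕ} (D : Dat K A m)

/-- Partial products. -/
def Xn (e : ℕ → ℤ) : ℕ → Aˣ
  | 0 => 1
  | (n+1) => Xn e n * D.T n ^ e n

/-- The monomial with exponents `e`. -/
def X (e : ℕ → ℤ) : Aˣ := D.Xn e (m+1)

theorem Xn_commute (e : ℕ → ℤ) (u : Aˣ) (n : ℕ) (h : ∀ l < n, e l ≠ 0 → Commute u (D.T l)) :
    Commute u (D.Xn e n) := by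
  induction n with
  | zero => exact Commute.one_right u
  | succ n ih =>
    refine (ih fun l hl => h l (by omega)).mul_right ?_
    by_cases h0 : e n = 0
    · rw [h0, zpow_zero]; exact Commute.one_right u
    · exact (h n (by omega) h0).zpow_right _

theorem Xn_congr (e e' : ℕ → ℤ) (n : ℕ) (h : ∀ l < n, e l = e' l) : D.Xn e n = D.Xn e' n := by
  induction n with
  | zero => rfl
  | succ n ih => rw [Xn, Xn, ih fun l hl => h l (by omega), h n (by omega)]

theorem Xn_single (e : ℕ → ℤ) (l : ℕ) (c : ℤ) (n : ℕ) (hn : n ≤ m + 1) (hl : l < n) :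
    D.Xn (e + Pi.single l c) n = D.Xn e n * D.T l ^ c := by
  induction n with
  | zero => omega
  | succ n ih =>
    rw [Xn, Xn]
    by_cases h : l = n
    · subst h
      rw [D.Xn_congr (e + (Pi.single l c : ℕ → ℤ)) e]
      · simp [zpow_add, mul_assoc]
      · intro l' hl'; simp [hl'.ne]
    · rw [ih (by omega) (by omega)]
      have : (Pi.single l c : ℕ → ℤ) n = 0 := Pi.single_eq_of_ne (Ne.symm h) _
      rw [Pi.add_apply, this, add_zero, mul_assoc, mul_assoc,
        ((D.commT l n (by omega) (by omega)).zpow_zpow _ _).eq]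

theorem X_single (e : ℕ → ℤ) (l : ℕ) (c : ℤ) (hl : l ≤ m) :
    D.X (e + Pi.single l c) = D.X e * D.T l ^ c := D.Xn_single e l c _ le_rfl (by omega)

theorem X_zero : D.X 0 = 1 := by
  have : ∀ n, D.Xn 0 n = 1 := by
    intro n
    induction n with
    | zero => rfl
    | succ n ih => rw [Xn, ih]; simp
  exact this _

theorem X_comm_T (e : ℕ → ℤ) (l : ℕ) (hl : l ≤ m) : Commute (D.T l) (D.X e) :=
  D.Xn_commute _ _ _ fun l' h _ => D.commT l l' hl (by omega)

/-- Span of monomials with exponents in `P`, times the subalgebra. -/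
def V (P : (ℕ → ℤ) → Prop) : Submodule K A :=
  Submodule.span K {z | ∃ e h, h ∈ D.S ∧ P e ∧ z = (D.X e : A) * h}

theorem V_mem {P : (ℕ → ℤ) → Prop} {e : ℕ → ℤ} {h : A} (hh : h ∈ D.S) (he : P e) :
    (D.X e : A) * h ∈ D.V P := Submodule.subset_span ⟨e, h, hh, he, rfl⟩

theorem V_mono {P P' : (ℕ → ℤ) → Prop} (h : ∀ e, P e → P' e) : D.V P ≤ D.V P' := by
  apply Submodule.span_mono
  rintro z ⟨e, k, hk, hQ, rfl⟩
  exact ⟨e, k, hk, h _ hQ, rfl⟩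

theorem V_right {P : (ℕ → ℤ) → Prop} {z h : A} (hz : z ∈ D.V P) (hh : h ∈ D.S) :
    z * h ∈ D.V P := by
  refine Submodule.span_induction ?_ ?_ ?_ ?_ hz
  · rintro _ ⟨e, k, hk, he, rfl⟩
    rw [mul_assoc]
    exact D.V_mem (mul_mem hk hh) he
  · simp
  · intro u v _ _ hu hv
    rw [add_mul]; exact add_mem hu hv
  · intro r u _ hu
    rw [smul_mul_assoc]; exact Submodule.smul_mem _ _ hu

theorem V_left {P P' : (ℕ → ℤ) → Prop} (a : A) (h : ∀ e, P e → a * (D.X e : A) ∈ D.V P')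
    {z : A} (hz : z ∈ D.V P) : a * z ∈ D.V P' := by
  refine Submodule.span_induction ?_ ?_ ?_ ?_ hz
  · rintro _ ⟨e, k, hk, he, rfl⟩
    rw [← mul_assoc]
    exact D.V_right (h e he) hk
  · simp
  · intro u v _ _ hu hv
    rw [mul_add]; exact add_mem hu hv
  · intro r u _ hu
    rw [mul_smul_comm]; exact Submodule.smul_mem _ _ hu

theorem T_left {P P' : (ℕ → ℤ) → Prop} (l : ℕ) (hl : l ≤ m) (c : ℤ)
    (h : ∀ e, P e → P' (e + Pi.single l c)) {z : A} (hz : z ∈ D.V P) :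
    ((D.T l ^ c : Aˣ) : A) * z ∈ D.V P' := by
  refine D.V_left _ (fun e he => ?_) hz
  rw [← Units.val_mul, ((D.X_comm_T e l hl).zpow_left c).eq, ← D.X_single e l c hl]
  have := D.V_mem D.S.one_mem (h e he)
  rwa [mul_one] at this

/-- Zeroing out two positions. -/
def z2 (e : ℕ → ℤ) (i : ℕ) : ℕ → ℤ := fun l => if l = i ∨ l = i + 1 then 0 else e l

theorem z2_eq (e : ℕ → ℤ) (i : ℕ) :
    e = z2 e i + Pi.single i (e i) + Pi.single (i+1) (e (i+1)) := by
  funext l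
  simp only [Pi.add_apply, z2]
  by_cases h1 : l = i
  · subst h1; simp
  · by_cases h2 : l = i + 1
    · subst h2; simp
    · simp [h1, h2]

theorem G_left {P P' : (ℕ → ℤ) → Prop} (i : ℕ) (hi : i + 1 ≤ m)
    (h : ∀ e, P e → ∀ c d, c + d = e i + e (i+1) →
      (e (i+1) = 0 → (|d| < |e i| ∨ (c = 0 ∧ d = e i))) →
      P' (z2 e i + Pi.single i c + Pi.single (i+1) d)) {z : A} (hz : z ∈ D.V P) :
    (D.G (i+1) : A) * z ∈ D.V P' := by
  refine D.V_left _ (fun e he => ?_) hz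
  have hX : ∀ c d, D.X (z2 e i + Pi.single i c + Pi.single (i+1) d)
      = D.X (z2 e i) * (D.T i ^ c * D.T (i+1) ^ d) := by
    intro c d
    rw [X_single _ _ _ _ hi, X_single _ _ _ _ (by omega), mul_assoc]
  have hc : Commute (D.G (i+1)) (D.X (z2 e i)) := by
    refine D.Xn_commute _ _ _ fun l hl h0 => D.commG i l hi (by omega) ?_ ?_
    · rintro rfl; simp [z2] at h0
    · rintro rfl; simp [z2] at h0
  have key := two_all D.S D.q D.qi D.hq (D.G (i+1)) (D.T i) (D.T (i+1)) (D.quad i hi) (D.memG i hi)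
    (D.hT i) (D.commT _ _ (by omega) hi) (e i) (e (i+1))
  have : (D.G (i+1) : A) * (D.X e : A) = (D.X (z2 e i) : A) *
      ((D.G (i+1) : A) * ((D.T i ^ e i * D.T (i+1) ^ e (i+1) : Aˣ) : A)) := by
    conv_lhs => rw [z2_eq e i, hX]
    rw [← Units.val_mul, ← Units.val_mul, ← Units.val_mul, ← mul_assoc, hc.eq, mul_assoc]
  rw [this]
  refine Submodule.span_induction ?_ ?_ ?_ ?_ key
  · rintro _ ⟨c, d, k, hk, ⟨h1, h2⟩, rfl⟩
    rw [← mul_assoc, ← Units.val_mul, ← hX]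
    exact D.V_mem hk (h e he c d h1 h2)
  · simp
  · intro u v _ _ hu hv
    rw [mul_add]; exact add_mem hu hv
  · intro r u _ hu
    rw [mul_smul_comm]; exact Submodule.smul_mem _ _ hu

theorem inv_mem (i : ℕ) (hi : i + 1 ≤ m) : (((D.G (i+1))⁻¹ : Aˣ) : A) ∈ D.S := by
  rw [inv_formula D.q D.qi D.hq _ (D.quad i hi)]
  exact add_mem (D.S.smul_mem (D.memG i hi) _) (D.S.smul_mem D.S.one_mem _)

theorem Ginv_left {P : (ℕ → ℤ) → Prop} (i : ℕ) (hi : i + 1 ≤ m)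
    (h : ∀ e, P e → ∀ c d, c + d = e i + e (i+1) →
      P (z2 e i + Pi.single i c + Pi.single (i+1) d)) {z : A} (hz : z ∈ D.V P) :
    (((D.G (i+1))⁻¹ : Aˣ) : A) * z ∈ D.V P := by
  rw [inv_formula D.q D.qi D.hq _ (D.quad i hi), add_mul, smul_mul_assoc, smul_mul_assoc, one_mul]
  exact add_mem (Submodule.smul_mem _ _ (D.G_left i hi (fun e he c d h1 _ => h e he c d h1) hz))
    (Submodule.smul_mem _ _ hz)

/-- The primed looping elements. -/
def tq : ℕ → Aˣ
  | 0 => D.T 0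
  | (j+1) => D.G (j+1) * tq j * (D.G (j+1))⁻¹

/-- Total degree. -/
def deg (m : ℕ) (e : ℕ → ℤ) : ℤ := ∑ l ∈ Finset.range (m+1), e l

theorem deg_single (e : ℕ → ℤ) (l : ℕ) (c : ℤ) (hl : l ≤ m) :
    deg m (e + Pi.single l c) = deg m e + c := by
  simp only [deg, Pi.add_apply, Finset.sum_add_distrib]
  simp [hl]

theorem deg_z2 (e : ℕ → ℤ) (i : ℕ) (hi : i + 1 ≤ m) (c d : ℤ) (h : c + d = e i + e (i+1)) :
    deg m (z2 e i + Pi.single i c + Pi.single (i+1) d) = deg m e := by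
  conv_rhs => rw [z2_eq e i]
  rw [deg_single _ _ _ hi, deg_single _ _ _ hi, deg_single _ _ _ (by omega),
    deg_single _ _ _ (by omega)]
  omega

theorem z2_of_ne (e : ℕ → ℤ) (i : ℕ) (c d : ℤ) (l : ℕ) (h1 : l ≠ i) (h2 : l ≠ i + 1) :
    (z2 e i + Pi.single i c + Pi.single (i+1) d : ℕ → ℤ) l = e l := by
  simp [z2, h1, h2]

theorem z2_left (e : ℕ → ℤ) (i : ℕ) (c d : ℤ) :
    (z2 e i + Pi.single i c + Pi.single (i+1) d : ℕ → ℤ) i = c := by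
  simp [z2]

theorem z2_right (e : ℕ → ℤ) (i : ℕ) (c d : ℤ) :
    (z2 e i + Pi.single i c + Pi.single (i+1) d : ℕ → ℤ) (i+1) = d := by
  simp [z2]

/-- Exponents with fixed entry at `j`, nothing above `j`, and given degree. -/
def Pst (m j : ℕ) (c s : ℤ) (e : ℕ → ℤ) : Prop := e j = c ∧ (∀ l, j < l → e l = 0) ∧ deg m e = s

theorem Pst_z2 {j : ℕ} {c s : ℤ} {e : ℕ → ℤ} (he : Pst m j c s e) (i : ℕ) (hi : i + 1 < j)
    (hj : j ≤ m) (a b : ℤ) (h : a + b = e i + e (i+1)) :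
    Pst m j c s (z2 e i + Pi.single i a + Pi.single (i+1) b) := by
  obtain ⟨h1, h2, h3⟩ := he
  refine ⟨?_, ?_, ?_⟩
  · rw [z2_of_ne _ _ _ _ _ (by omega) (by omega), h1]
  · intro l hl
    rw [z2_of_ne _ _ _ _ _ (by omega) (by omega), h2 l hl]
  · rw [deg_z2 _ _ (by omega) _ _ h, h3]

theorem tq_zpow (l : ℕ) (k : ℤ) :
    D.tq (l+1) ^ k = D.G (l+1) * D.tq l ^ k * (D.G (l+1))⁻¹ := by
  rw [tq, conj_zpow]

theorem stepA (j : ℕ) (hj : j ≤ m) (c k : ℤ) (l : ℕ) (hl : l < j) (s : ℤ) (z : A)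
    (hz : z ∈ D.V (Pst m j c s)) : ((D.tq l ^ k : Aˣ) : A) * z ∈ D.V (Pst m j c (s + k)) := by
  induction l generalizing z with
  | zero =>
    refine D.T_left 0 (by omega) k ?_ hz
    rintro e ⟨h1, h2, h3⟩
    refine ⟨?_, ?_, ?_⟩
    · simp [h1, hl.ne']
    · intro l h
      have : l ≠ 0 := by omega
      simp [h2 l h, this]
    · rw [deg_single _ _ _ (by omega), h3]
  | succ l ih =>
    rw [tq_zpow, Units.val_mul, Units.val_mul, mul_assoc, mul_assoc]
    refine D.G_left l (by omega) (fun e he a b h _ => Pst_z2 he l hl hj a b h) ?_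
    refine ih (by omega) _ ?_
    exact D.Ginv_left l (by omega) (fun e he a b h => Pst_z2 he l hl hj a b h) hz

/-- Exponents occurring in the expansion of `primed element powers`. -/
def Pc (m j : ℕ) (k : ℤ) (e : ℕ → ℤ) : Prop :=
  (∀ l, j < l → e l = 0) ∧ deg m e = k ∧ (|e j| < |k| ∨ e = Pi.single j k)

theorem stepB (j : ℕ) (hj : j ≤ m) (k : ℤ) : ((D.tq j ^ k : Aˣ) : A) ∈ D.V (Pc m j k) := by
  induction j with
  | zero =>
    have h1 : D.T 0 ^ k = D.X (0 + Pi.single 0 k) := by rw [X_single _ _ _ _ hj, X_zero, one_mul]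
    have := D.V_mem (P := Pc m 0 k) (e := 0 + Pi.single 0 k) D.S.one_mem (by
      refine ⟨?_, ?_, ?_⟩
      · intro l hl; simp [hl.ne']
      · rw [deg_single _ _ _ hj]; simp [deg]
      · right; simp)
    rw [mul_one] at this
    rwa [tq, h1]
  | succ j ih =>
    rw [tq_zpow, Units.val_mul, Units.val_mul]
    refine D.V_right ?_ (D.inv_mem j hj)
    refine D.G_left j hj ?_ (ih (by omega))
    rintro e ⟨h1, h2, h3⟩ c d hcd hd
    have h0 := h1 (j+1) (by omega)
    specialize hd h0
    refine ⟨?_, ?_, ?_⟩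
    · intro l hl
      rw [z2_of_ne _ _ _ _ _ (by omega) (by omega), h1 l (by omega)]
    · rw [deg_z2 _ _ hj _ _ hcd, h2]
    · rw [z2_right]
      rcases h3 with h3 | h3
      · left
        rcases hd with hd | ⟨_, hd⟩
        · exact hd.trans h3
        · rwa [hd]
      · have hej : e j = k := by rw [h3]; simp
        rcases hd with hd | ⟨hc, hd⟩
        · left; rwa [hej] at hd
        · right
          subst hc
          rw [hd, hej]
          have : z2 e j = 0 := by
            funext l
            by_cases hl : l = j
            · simp [z2, hl]
            · simp [z2, h3, hl]
          rw [this]; simp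

/-- Products of powers of primed elements. -/
def Pn (k : ℕ → ℤ) : ℕ → Aˣ
  | 0 => 1
  | (n+1) => Pn k n * D.tq n ^ k n

theorem stepA' (k : ℕ → ℤ) (j : ℕ) (hj : j ≤ m) (c : ℤ) (n : ℕ) (hn : n ≤ j) (s : ℤ) (z : A)
    (hz : z ∈ D.V (Pst m j c s)) :
    (D.Pn k n : A) * z ∈ D.V (Pst m j c (s + ∑ l ∈ Finset.range n, k l)) := by
  induction n generalizing z s with
  | zero => simpa [Pn] using hz
  | succ n ih =>
    rw [Pn, Units.val_mul, mul_assoc, Finset.sum_range_succ, add_comm _ (k n), ← add_assoc]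
    exact ih (by omega) _ _ (D.stepA j hj c (k n) n (by omega) s z hz)

theorem tq_comm (j l : ℕ) (hj : j ≤ m) (hl : l < j) : Commute (D.tq l) (D.T j) := by
  induction l with
  | zero => exact D.commT _ _ (by omega) hj
  | succ l ih =>
    have := D.commG l j (by omega) hj (by omega) (by omega)
    exact (this.mul_left (ih (by omega))).mul_left this.inv_left

theorem Pn_comm (k : ℕ → ℤ) (j n : ℕ) (hj : j ≤ m) (hn : n ≤ j) : Commute (D.Pn k n) (D.T j) := by
  induction n with
  | zero => exact Commute.one_left _
  | succ n ih =>
    exact (ih (by omega)).mul_left ((D.tq_comm j n hj (by omega)).zpow_left _)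

/-- Exponents occurring in the expansion of the product of the first `n` primed powers. -/
def Pf (m : ℕ) (k : ℕ → ℤ) (n : ℕ) (e : ℕ → ℤ) : Prop :=
  (∀ l, n ≤ l → e l = 0) ∧ deg m e = ∑ l ∈ Finset.range n, k l ∧
    ((∀ l < n, e l = k l) ∨ ∃ a < n, (∀ l < n, a < l → e l = k l) ∧ |e a| < |k a|)

theorem stepC (k : ℕ → ℤ) (n : ℕ) (hn : n ≤ m + 1) : (D.Pn k n : A) ∈ D.V (Pf m k n) := by
  induction n with
  | zero =>
    have := D.V_mem (P := Pf m k 0) (e := 0) D.S.one_mem (by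
      refine ⟨by simp, by simp [deg], by simp⟩)
    simpa [X_zero, Pn] using this
  | succ n ih =>
    rw [Pn, Units.val_mul]
    refine D.V_left _ ?_ (D.stepB n (by omega) (k n))
    rintro e ⟨h1, h2, h3 | h3⟩
    · have hm : (D.X e : A) * 1 ∈ D.V (Pst m n (e n) (k n)) :=
        D.V_mem D.S.one_mem ⟨rfl, h1, h2⟩
      rw [mul_one] at hm
      refine D.V_mono ?_ (D.stepA' k n (by omega) (e n) n le_rfl _ _ hm)
      rintro e' ⟨g1, g2, g3⟩
      refine ⟨fun l hl => g2 l (by omega), ?_, Or.inr ⟨n, by omega, ?_, ?_⟩⟩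
      · rw [g3, Finset.sum_range_succ, add_comm]
      · intro l hl1 hl2; omega
      · rwa [g1]
    · have hX : D.X e = D.T n ^ k n := by
        rw [h3, ← zero_add (Pi.single n (k n) : ℕ → ℤ), X_single _ _ _ _ (by omega), X_zero, one_mul]
      rw [hX, ← Units.val_mul, ((D.Pn_comm k n n (by omega) le_rfl).zpow_right _).eq, Units.val_mul]
      refine D.T_left n (by omega) (k n) ?_ (ih (by omega))
      rintro e' ⟨g1, g2, g3⟩
      refine ⟨?_, ?_, ?_⟩
      · intro l hl
        have : l ≠ n := by omega
        simp [this, g1 l (by omega)]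
      · rw [deg_single _ _ _ (by omega), g2, Finset.sum_range_succ]
      · have key : ∀ l < n + 1, (l < n → e' l = k l) → (e' + Pi.single n (k n) : ℕ → ℤ) l = k l := by
          intro l hl h
          by_cases hln : l = n
          · subst hln; simp [g1 l le_rfl]
          · simp [hln, h (by omega)]
        rcases g3 with g3 | ⟨a, ha, g3, g4⟩
        · left
          exact fun l hl => key l hl (g3 l)
        · right
          refine ⟨a, by omega, fun l hl hal => key l hl fun h => g3 l h hal, ?_⟩
          simpa [ha.ne] using g4

end Dat

end Generic

section Braid

variable {m : ℕ}

theorem rel_one {r : FreeGroup (MBGen m)} (h : r ∈ rels m) : PresentedGroup.mk (rels m) r = 1 :=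
  (QuotientGroup.eq_one_iff r).2 (Subgroup.subset_normalClosure h)

theorem sig_of (i : ℕ) (hi : i < m) : (sig (i+1) : B m) = σ ⟨i, hi⟩ := by
  simp [sig, hi]

theorem sig_big (i : ℕ) (hi : ¬ i < m) : (sig (i+1) : B m) = 1 := by
  simp [sig, hi]

theorem rel_t : (sig 1 : B m) * τ * sig 1 * τ = τ * sig 1 * τ * sig 1 := by
  by_cases h : 0 < m
  · rw [sig_of 0 h]
    have := rel_one (m := m) (Or.inl ⟨h, rfl⟩)
    rw [map_mul, map_inv, mul_inv_eq_one, map_pow, map_pow, map_mul, map_mul, pow_two, pow_two] at this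
    simp only [mul_assoc] at this ⊢
    exact this
  · rw [sig_big 0 h]; simp

theorem rel_ts (i : ℕ) : Commute (sig (i+2) : B m) τ := by
  by_cases h : i + 1 < m
  · rw [sig_of (i+1) h]
    have := rel_one (m := m) (Or.inr (Or.inl ⟨⟨i+1, h⟩, by simp, rfl⟩))
    rw [map_mul, map_inv, mul_inv_eq_one, map_mul, map_mul] at this
    exact this.symm
  · rw [sig_big (i+1) h]; exact Commute.one_left _

theorem rel_ss (i j : ℕ) (hij : i + 1 < j) : Commute (sig (i+1) : B m) (sig (j+1)) := by
  by_cases h : j < m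
  · rw [sig_of i (by omega), sig_of j h]
    have := rel_one (m := m) (Or.inr (Or.inr (Or.inr ⟨⟨i, by omega⟩, ⟨j, h⟩, hij, rfl⟩)))
    rw [map_mul, map_inv, mul_inv_eq_one, map_mul, map_mul] at this
    exact this
  · rw [sig_big j h]; exact Commute.one_right _

theorem rel_braid (i : ℕ) (h : i + 1 < m) :
    (sig (i+1) : B m) * sig (i+2) * sig (i+1) = sig (i+2) * sig (i+1) * sig (i+2) := by
  rw [sig_of i (by omega), sig_of (i+1) h]
  have := rel_one (m := m) (Or.inr (Or.inr (Or.inl ⟨⟨i, by omega⟩, ⟨i+1, h⟩, rfl, rfl⟩)))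
  rw [map_mul, map_inv, mul_inv_eq_one, map_mul, map_mul, map_mul, map_mul] at this
  exact this

theorem sig_tt_low (i l : ℕ) (h : l < i) : Commute (sig (i+1) : B m) (tt l) := by
  induction l with
  | zero =>
    obtain ⟨i, rfl⟩ : ∃ j, i = j + 1 := ⟨i - 1, by omega⟩
    exact rel_ts i
  | succ l ih =>
    have := (rel_ss (m := m) l i h).symm
    exact (this.mul_right (ih (by omega))).mul_right this

theorem sig_tt_next (i : ℕ) (h : i + 1 < m) : Commute (sig (i+1) : B m) (tt (i+2)) := by
  have hb := rel_braid i h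
  have hc := sig_tt_low (m := m) (i+1) i (by omega)
  show (sig (i+1) : B m) * (sig (i+2) * (sig (i+1) * tt i * sig (i+1)) * sig (i+2))
    = (sig (i+2) * (sig (i+1) * tt i * sig (i+1)) * sig (i+2)) * sig (i+1)
  calc (sig (i+1) : B m) * (sig (i+2) * (sig (i+1) * tt i * sig (i+1)) * sig (i+2))
      = (sig (i+1) * sig (i+2) * sig (i+1)) * (tt i * sig (i+1) * sig (i+2)) := by
        simp only [mul_assoc]
    _ = sig (i+2) * sig (i+1) * (sig (i+2) * tt i) * (sig (i+1) * sig (i+2)) := by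
        rw [hb]; simp only [mul_assoc]
    _ = sig (i+2) * sig (i+1) * tt i * (sig (i+2) * sig (i+1) * sig (i+2)) := by
        rw [hc.eq]; simp only [mul_assoc]
    _ = _ := by rw [← hb]; simp only [mul_assoc]

theorem sig_tt_high (i l : ℕ) (h : i + 1 < l) (hl : l ≤ m) : Commute (sig (i+1) : B m) (tt l) := by
  induction l with
  | zero => omega
  | succ l ih =>
    by_cases hil : i + 1 = l
    · subst hil; exact sig_tt_next i (by omega)
    · have := rel_ss (m := m) i l (by omega)
      exact (this.mul_right (ih (by omega) (by omega))).mul_right this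

theorem t_tt (j : ℕ) : Commute (τ : B m) (tt j) := by
  induction j with
  | zero => exact Commute.refl _
  | succ j ih =>
    cases j with
    | zero =>
      show (τ : B m) * (sig 1 * τ * sig 1) = (sig 1 * τ * sig 1) * τ
      rw [rel_t]; simp only [mul_assoc]
    | succ j =>
      have := (rel_ts (m := m) j).symm
      exact (this.mul_right ih).mul_right this

theorem tt_comm_lt (l j : ℕ) (h : l < j) (hj : j ≤ m) : Commute (tt l : B m) (tt j) := by
  induction l with
  | zero => exact t_tt j
  | succ l ih =>
    have := sig_tt_high (m := m) l j h hj
    exact (this.mul_left (ih (by omega))).mul_left this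

theorem tt_comm (i j : ℕ) (hi : i ≤ m) (hj : j ≤ m) : Commute (tt i : B m) (tt j) := by
  rcases lt_trichotomy i j with h | h | h
  · exact tt_comm_lt i j h hj
  · subst h; exact Commute.refl _
  · exact (tt_comm_lt j i h hi).symm

theorem pih_quad (i : Fin m) : pih m (σ i) * pih m (σ i) =
    (qq - 1) • pih m (σ i) + qq • (1 : H m) := by
  have h := RingQuot.mkAlgHom_rel R (heckeRel.quad i)
  have hp : ∀ b, pih m b = RingQuot.mkAlgHom R (heckeRel m) (MonoidAlgebra.of R (B m) b) := by
    intro b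
    show RingQuot.mkRingHom (heckeRel m) _ = _
    rw [← RingQuot.mkAlgHom_coe R]; rfl
  rw [map_mul, map_add, map_smul, map_smul, map_one, ← hp] at h
  exact h

/-- The concrete data. -/
noncomputable def dat (m : ℕ) : Dat R (H m) m where
  S := HA m
  q := qq
  qi := LaurentPolynomial.T (-1)
  hq := by rw [qq, ← LaurentPolynomial.T_add]; simp
  G i := (pih m).toHomUnits (sig i)
  T i := (pih m).toHomUnits (tt i)
  hT i := by rw [← map_mul, ← map_mul]; rfl
  commT i j hi hj := (tt_comm i j hi hj).map _
  commG i l hi hl h1 h2 := by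
    refine Commute.map ?_ _
    rcases Nat.lt_or_ge l i with h | h
    · exact sig_tt_low i l h
    · exact sig_tt_high i l (by omega) hl
  quad i hi := by
    rw [MonoidHom.coe_toHomUnits, sig_of i (by omega)]
    exact pih_quad _
  memG i hi := by
    rw [MonoidHom.coe_toHomUnits, sig_of i (by omega)]
    exact Algebra.subset_adjoin ⟨_, rfl⟩

theorem dat_tq (l : ℕ) : (dat m).tq l = (pih m).toHomUnits (tp l) := by
  induction l with
  | zero => rfl
  | succ l ih =>
    rw [Dat.tq, ih, tp, map_mul, map_mul, map_inv]; rfl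

theorem dat_Xn (e : ℕ → ℤ) (n : ℕ) : (dat m).Xn e n =
    (pih m).toHomUnits (List.ofFn fun i : Fin n => tt (i : ℕ) ^ e i).prod := by
  induction n with
  | zero => simp [Dat.Xn]
  | succ n ih =>
    rw [Dat.Xn, ih, List.ofFn_succ_last, List.prod_append, map_mul, List.prod_singleton, map_zpow]
    rfl

theorem dat_Pn (e : ℕ → ℤ) (n : ℕ) : (dat m).Pn e n =
    (pih m).toHomUnits (List.ofFn fun i : Fin n => tp (i : ℕ) ^ e i).prod := by
  induction n with
  | zero => simp [Dat.Pn]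
  | succ n ih =>
    rw [Dat.Pn, ih, List.ofFn_succ_last, List.prod_append, map_mul, List.prod_singleton, map_zpow,
      dat_tq]
    rfl

theorem exists_TMon (e : ℕ → ℤ) (n : ℕ) (hn : n ≤ m + 1) :
    ∃ T : TMon m, T.elem = (List.ofFn fun i : Fin n => (tt (i : ℕ) : B m) ^ e i).prod ∧
      T.expSum = ∑ l ∈ Finset.range n, e l ∧ (∀ j, T.ind j < n) ∧ T.r ≤ n ∧
      ((∃ l < n, e l = 0) → T.r < n) := by
  induction n with
  | zero =>
    refine ⟨⟨0, Fin.elim0, Fin.elim0, fun i => i.elim0, fun i => i.elim0, fun i => i.elim0⟩,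
      ?_, ?_, ?_, ?_, ?_⟩
    · simp [TMon.elem]
    · simp [TMon.expSum]
    · exact fun i => i.elim0
    · simp
    · simp
  | succ n ih =>
    obtain ⟨T, h1, h2, h3, h4, h5⟩ := ih (by omega)
    by_cases h0 : e n = 0
    · refine ⟨T, ?_, ?_, fun j => (h3 j).trans (by omega), by omega, fun _ => by omega⟩
      · rw [h1, List.ofFn_succ_last, List.prod_append]
        simp [h0]
      · rw [h2, Finset.sum_range_succ, h0, add_zero]
    · refine ⟨⟨T.r + 1, Fin.snoc T.ind n, Fin.snoc T.ke (e n), ?_, ?_, ?_⟩, ?_, ?_, ?_, ?_, ?_⟩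
      · intro a b
        refine Fin.lastCases ?_ (fun b => ?_) b
        · refine Fin.lastCases ?_ (fun a => ?_) a
          · intro h; exact absurd h (lt_irrefl _)
          · intro _; simpa using h3 a
        · refine Fin.lastCases ?_ (fun a => ?_) a
          · intro h; exact absurd h (not_lt.2 (Fin.le_last _))
          · intro h; simpa using T.mono (by simpa using h)
      · intro j
        refine Fin.lastCases ?_ (fun j => ?_) j
        · simp; omega
        · simpa using T.bdd j
      · intro j
        refine Fin.lastCases ?_ (fun j => ?_) j
        · simpa using h0
        · simpa using T.nz j
      · rw [TMon.elem] at h1 ⊢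
        rw [List.ofFn_succ_last, List.ofFn_succ_last, List.prod_append, List.prod_append]
        simp only [Fin.snoc_castSucc, Fin.snoc_last, Fin.val_castSucc, Fin.val_last]
        rw [h1]
      · rw [TMon.expSum] at h2 ⊢
        dsimp only
        rw [Fin.sum_univ_castSucc, Finset.sum_range_succ, ← h2]
        simp
      · intro j
        refine Fin.lastCases ?_ (fun j => ?_) j
        · simp
        · simpa using (h3 j).trans (Nat.lt_succ_self n)
      · simpa using h4
      · rintro ⟨l, hl, hl0⟩
        have : l ≠ n := by rintro rfl; exact h0 hl0
        have := h5 ⟨l, by omega, hl0⟩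
        show T.r + 1 < n + 1
        omega

theorem le_ind (T : TMon m) (a : ℕ) (ha : a < T.r) : a ≤ T.ind ⟨a, ha⟩ := by
  induction a with
  | zero => omega
  | succ a ih =>
    have h1 := ih (by omega)
    have h2 : T.ind ⟨a, by omega⟩ < T.ind ⟨a+1, ha⟩ := T.mono (by simp)
    omega

/-- The full monomial. -/
def full (m : ℕ) (k : Fin (m+1) → ℤ) (hk : ∀ i, k i ≠ 0) : TMon m :=
  ⟨m+1, fun j => (j : ℕ), k, fun _ _ h => h, fun j => Nat.lt_succ_iff.mp j.isLt, hk⟩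

theorem full_top (k : Fin (m+1) → ℤ) (hk : ∀ i, k i ≠ 0) : (full m k hk).topIdx = m := by
  simp only [TMon.topIdx, full]
  rw [List.ofFn_succ_last]; simp

theorem lt_of_short (k : Fin (m+1) → ℤ) (hk : ∀ i, k i ≠ 0) (T : TMon m)
    (hs : T.expSum = (full m k hk).expSum) (hr : T.r < m + 1) : T.lt (full m k hk) := by
  refine Or.inr ⟨hs, ?_⟩
  rw [full_top]
  rcases Nat.eq_zero_or_pos T.r with h0 | h0
  · have : T.topIdx = 0 := by
      have : List.ofFn T.ind = [] := List.ofFn_eq_nil_iff.2 h0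
      simp [TMon.topIdx, this]
    rw [this]
    rcases Nat.eq_zero_or_pos m with hm | hm
    · exfalso
      subst hm
      have e1 : T.expSum = 0 := by
        obtain ⟨r, ind, ke, _, _, _⟩ := T
        dsimp only at h0
        subst h0
        simp [TMon.expSum]
      have e2 : (full 0 k hk).expSum = k 0 := by
        rw [TMon.expSum, full]
        exact Fin.sum_univ_one _
      exact hk 0 (by rw [← e2, ← hs, e1])
    · exact Or.inl hm
  · have ht : T.topIdx = T.ind ⟨T.r - 1, by omega⟩ := by
      have hne : List.ofFn T.ind ≠ [] := fun h => by
        have := List.ofFn_eq_nil_iff.1 h; omega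
      rw [TMon.topIdx, List.getLast?_eq_some_getLast hne, List.getLast_ofFn]; rfl
    rcases Nat.lt_or_ge T.topIdx m with h | h
    · exact Or.inl h
    · have hb := T.bdd ⟨T.r - 1, by omega⟩
      refine Or.inr ⟨by omega, Or.inl ?_⟩
      have hex : ∃ a, ∃ ha : a < T.r, a < T.ind ⟨a, ha⟩ := ⟨T.r - 1, by omega, by omega⟩
      classical
      obtain ⟨ha, hlt⟩ := Nat.find_spec hex
      refine ⟨Nat.find hex, ha, by show _ < m + 1; omega, ?_, hlt⟩
      intro b hb1 hb2 hb
      have h1 := Nat.find_min hex hb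
      push Not at h1
      exact le_antisymm (h1 hb1) (le_ind T b hb1)

theorem gen_case (k : ℕ → ℤ) (hk : ∀ i : Fin (m+1), k i ≠ 0) (e : ℕ → ℤ)
    (he : Dat.Pf m k (m+1) e) :
    (∀ l < m + 1, e l = k l) ∨ ∃ T : TMon m, T.lt (full m (fun i => k i) hk) ∧
      ((dat m).X e : H m) = pih m T.elem := by
  obtain ⟨_, h2, h3⟩ := he
  rcases h3 with h3 | ⟨a, ha, h3, h4⟩
  · exact Or.inl h3
  · right
    have hfs : (full m (fun i => k i) hk).expSum = ∑ l ∈ Finset.range (m+1), k l := by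
      rw [TMon.expSum, full, ← Fin.sum_univ_eq_sum_range]
    by_cases hz : ∃ l < m + 1, e l = 0
    · obtain ⟨T, g1, g2, _, _, g5⟩ := exists_TMon (m := m) e (m+1) le_rfl
      refine ⟨T, lt_of_short _ hk T ?_ (g5 hz), ?_⟩
      · rw [g2, hfs, ← h2]; rfl
      · rw [Dat.X, dat_Xn, g1]; rfl
    · push Not at hz
      refine ⟨full m (fun i => e i) (fun i => hz i i.2), Or.inr ⟨?_, Or.inr ⟨?_, Or.inr ⟨rfl, ?_⟩⟩⟩, ?_⟩
      · rw [hfs, ← h2, TMon.expSum, full, Dat.deg, ← Fin.sum_univ_eq_sum_range]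
      · rw [full_top, full_top]
      · refine ⟨a, ha, ha, ?_, ?_, Or.inl h4⟩
        · intro h
          have h' : e a = k a := h
          rw [h'] at h4; exact lt_irrefl _ h4
        · intro b hb _ hab
          exact h3 b hb hab
      · rw [Dat.X, dat_Xn]; rfl

theorem exists_small (k : Fin (m+1) → ℤ) (hk : ∀ i, k i ≠ 0) : ∃ T : TMon m, T.lt (full m k hk) := by
  refine ⟨⟨1, fun _ => 0, fun _ => -(|(full m k hk).expSum| + 1), ?_, by simp, ?_⟩, Or.inl ?_⟩
  · intro a b h
    exact absurd h (by simp [Subsingleton.elim a b])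
  · intro _
    have := abs_nonneg (full m k hk).expSum
    omega
  · have := neg_abs_le (full m k hk).expSum
    simp only [TMon.expSum, Finset.univ_unique, Finset.sum_singleton] at this ⊢
    omega

end Braid

/-- In `H_{1,m+1}(q)`:
`t^{k_0}(t′_1)^{k_1}⋯(t′_m)^{k_m} = q^{−Σ n k_n}·t^{k_0}t_1^{k_1}⋯t_m^{k_m}
+ Σ_i f_i·t^{k_0}⋯t_m^{k_m}·w_i + Σ_j g_j·τ_j·u_j`,
where `w_i, u_j ∈ H_{m+1}(q)` and each `τ_j` is a monomial in the `t_i`'s smaller than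
`t^{k_0}t_1^{k_1}⋯t_m^{k_m}` in the ordering of monomials. -/
theorem lambda_prime_word_expansion (m : ℕ) (k : Fin (m+1) → ℤ) (hk : ∀ i, k i ≠ 0) :
    ∃ (N : ℕ) (f g : Fin N → R) (w u : Fin N → H m) (T : Fin N → TMon m),
      (∀ i, w i ∈ HA m) ∧ (∀ i, u i ∈ HA m) ∧
      (∀ i, TMon.lt (T i)
        ⟨m+1, fun j => (j : ℕ), k, fun _ _ h => h, fun j => Nat.lt_succ_iff.mp j.isLt, hk⟩) ∧
      pih m ((List.ofFn fun i : Fin (m+1) => tp (i : ℕ) ^ k i).prod) =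
        (LaurentPolynomial.T (-(∑ i : Fin (m+1), (i : ℤ) * k i)) : R) •
            pih m ((List.ofFn fun i : Fin (m+1) => tt (i : ℕ) ^ k i).prod) +
          (∑ i, f i •
            (pih m ((List.ofFn fun i : Fin (m+1) => tt (i : ℕ) ^ k i).prod) * w i)) +
          ∑ i, g i • (pih m (T i).elem * u i) := by
  classical
  set k' : ℕ → ℤ := fun l => if h : l < m + 1 then k ⟨l, h⟩ else 0 with hk'
  have hkk : ∀ i : Fin (m+1), k' i = k i := fun i => by
    rw [hk']; dsimp only; rw [dif_pos i.2]
  have hkf : (fun i : Fin (m+1) => k' i) = k := funext hkk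
  have hk0 : ∀ i : Fin (m+1), k' i ≠ 0 := fun i => by rw [hkk]; exact hk i
  set Λ : H m := pih m ((List.ofFn fun i : Fin (m+1) => tt (i : ℕ) ^ k i).prod) with hΛ
  have hP : pih m ((List.ofFn fun i : Fin (m+1) => tp (i : ℕ) ^ k i).prod) =
      ((dat m).Pn k' (m+1) : H m) := by
    rw [dat_Pn, MonoidHom.coe_toHomUnits]; simp only [hkk]
  have hX : ((dat m).X k' : H m) = Λ := by
    rw [Dat.X, dat_Xn, MonoidHom.coe_toHomUnits]; simp only [hkk, hΛ]
  set c : R := LaurentPolynomial.T (-(∑ i : Fin (m+1), (i : ℤ) * k i)) with hc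
  have hmem := (dat m).stepC k' (m+1) le_rfl
  have hkP : Dat.Pf m k' (m+1) k' := by
    refine ⟨?_, rfl, Or.inl fun _ _ => rfl⟩
    intro l hl
    rw [hk']; dsimp only; rw [dif_neg (by omega)]
  have hmem2 : ((dat m).Pn k' (m+1) : H m) + (-c) • Λ ∈ (dat m).V (Dat.Pf m k' (m+1)) := by
    refine add_mem hmem (Submodule.smul_mem _ _ ?_)
    have := (dat m).V_mem (dat m).S.one_mem hkP
    rwa [mul_one, hX] at this
  obtain ⟨T0, hT0⟩ := exists_small k hk
  obtain ⟨N, f, g, hsum⟩ := Submodule.mem_span_set'.1 hmem2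
  have hgen : ∀ i, ∃ (w u : H m) (T : TMon m), w ∈ HA m ∧ u ∈ HA m ∧ T.lt (full m k hk) ∧
      (g i : H m) = Λ * w + pih m T.elem * u := by
    intro i
    obtain ⟨e, h, hh, he, hz⟩ := (g i).2
    rcases gen_case k' hk0 e he with h1 | ⟨T, hT, hTe⟩
    · refine ⟨h, 0, T0, hh, zero_mem _, hT0, ?_⟩
      rw [hz, mul_zero, add_zero, ← hX, Dat.X, Dat.X, (dat m).Xn_congr e k' _ h1]
    · refine ⟨0, h, T, zero_mem _, hh, ?_, ?_⟩
      · convert hT using 2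
        exact hkf.symm
      · rw [hz, mul_zero, zero_add, hTe]
  choose w u T hw hu hT hg using hgen
  refine ⟨N, f, f, w, u, T, hw, hu, hT, ?_⟩
  rw [hP, add_assoc, ← Finset.sum_add_distrib]
  have hs2 : ∑ i, (f i • (Λ * w i) + f i • (pih m (T i).elem * u i)) =
      ((dat m).Pn k' (m+1) : H m) + (-c) • Λ := by
    rw [← hsum]
    refine Finset.sum_congr rfl fun i _ => ?_
    rw [hg i, smul_add]
  rw [hs2, add_left_comm, ← add_smul, add_neg_cancel, zero_smul, add_zero]

end MB
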